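/- arXiv:1308.5844 — 3 statements merged into one kernel-verified Lean document; each statement's English description precedes it below -/
import Mathlib

section
/- Let H be a limit sparse numerical semigroup with odd Frobenius number ℓ_g = 2g - (2r + 1) = 6r + 1 (so g = 4r + 1). If the multiplicity of H (its smallest positive element) is odd, then H is one of the following: (1) H = 3ℕ + H_{6r+1}, i.e., H = {3k : k ∈ ℕ, 3k ≤ 6r} ∪ {n ∈ ℕ : n ≥ 6r + 2}; or (2) r > 1 and H = {0} ∪ {2j + 1 : j ∈ ℕ, r ≤ j ≤ 2r - 1} ∪ {2j : j ∈ ℕ, 2r + 1 ≤ j ≤ 3r} ∪ {n ∈ ℕ : n ≥ 6r + 2}. -/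
/-- `H` is a numerical semigroup of genus `g`: it contains `0`, is closed under
addition, and its complement in `ℕ` (the set of gaps) is finite with exactly
`g` elements. -/
def IsNumericalSemigroupOfGenus (H : Set ℕ) (g : ℕ) : Prop :=
  0 ∈ H ∧ (∀ a ∈ H, ∀ b ∈ H, a + b ∈ H) ∧ Hᶜ.Finite ∧ Hᶜ.ncard = g

/-- The `i`-th gap `ℓ_i` of `H` (1-indexed): the `i`-th smallest element of `ℕ \ H`.
In particular, if `H` has genus `g`, then `gap H g` is the Frobenius number of `H`. -/
noncomputable def gap (H : Set ℕ) (i : ℕ) : ℕ :=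
  Nat.nth (fun n => n ∉ H) (i - 1)

/-- A numerical semigroup `H` of genus `g` is sparse if any two subsequent gaps
differ by at most `2`. -/
def IsSparse (H : Set ℕ) (g : ℕ) : Prop :=
  ∀ i, 1 ≤ i → i ≤ g - 1 → gap H (i + 1) - gap H i ≤ 2

/-- `D`, the number of double leaps of `H` (of genus `g`). -/
noncomputable def numDouble (H : Set ℕ) (g : ℕ) : ℕ :=
  {i : ℕ | 1 ≤ i ∧ i ≤ g - 1 ∧ gap H (i + 1) - gap H i = 2}.ncard

/-- `S`, the number of single leaps of `H` (of genus `g`). -/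
noncomputable def numSingle (H : Set ℕ) (g : ℕ) : ℕ :=
  {i : ℕ | 1 ≤ i ∧ i ≤ g - 1 ∧ gap H (i + 1) - gap H i = 1}.ncard

/-- The multiplicity of `H`: its smallest positive element. -/
noncomputable def multOf (H : Set ℕ) : ℕ :=
  sInf {n : ℕ | n ∈ H ∧ 0 < n}

/-- In `ZMod m` with `m` odd, let `R` contain no two cyclically consecutive elements. If a sumset
of two sets containing `0` lies in `R`, then the two sets are small or `R` is periodic. -/
theorem ZMod.card_add_card_le_or_periodic {m : ℕ} [NeZero m] (hm : Odd m) (R : Finset (ZMod m))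
    (hR : ∀ x ∈ R, x + 1 ∉ R) (X Y : Finset (ZMod m)) (hX : 0 ∈ X) (hY : 0 ∈ Y)
    (hXY : ∀ x ∈ X, ∀ y ∈ Y, x + y ∈ R) :
    2 * (X.card + Y.card) ≤ m + 1 ∨ ∃ s : ZMod m, s ≠ 0 ∧ ∀ z ∈ R, z + s ∈ R := by
  have indep (Q : Finset (ZMod m)) (hQ : ∀ x ∈ Q, x + 1 ∉ Q) : 2 * Q.card + 1 ≤ m := by
    have hdisj : Disjoint Q (Q.image (· + 1)) := by
      rw [Finset.disjoint_right]
      intro a ha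
      obtain ⟨b, hb, rfl⟩ := Finset.mem_image.1 ha
      exact hQ b hb
    have h := Finset.card_le_univ (Q ∪ Q.image (· + 1))
    rw [Finset.card_union_of_disjoint hdisj,
      Finset.card_image_of_injective _ (add_left_injective 1), ZMod.card] at h
    obtain ⟨k, rfl⟩ := hm
    omega
  induction hn : X.card using Nat.strong_induction_on generalizing X Y with
  | _ n ih =>
  subst hn
  by_cases hclosed : ∀ x ∈ X, ∀ y ∈ Y, x + y ∈ Y
  · have hYR : Y ⊆ R := fun y hy => by simpa using hXY 0 hX y hy
    by_cases hRY : R ⊆ Y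
    · by_cases hx : ∃ x ∈ X, x ≠ 0
      · obtain ⟨x, hx, hx0⟩ := hx
        exact Or.inr ⟨x, hx0, fun z hz => hYR (by rw [add_comm]; exact hclosed x hx z (hRY hz))⟩
      · push Not at hx
        have hX1 : X.card ≤ 1 :=
          Finset.card_le_one.2 fun a ha b hb => by rw [hx a ha, hx b hb]
        have := indep R hR
        have := Finset.card_le_card hYR
        left
        omega
    · obtain ⟨z, hzR, hzY⟩ := Finset.not_subset.1 hRY
      have hsub : ∀ x ∈ X, ∀ y ∈ Y, y - x ∈ Y := by
        intro x hx y hy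
        have himg : Y.image (x + ·) = Y := by
          apply Finset.eq_of_subset_of_card_le
          · intro a ha
            obtain ⟨b, hb, rfl⟩ := Finset.mem_image.1 ha
            exact hclosed x hx b hb
          · rw [Finset.card_image_of_injective _ (add_right_injective x)]
        rw [← himg] at hy
        obtain ⟨b, hb, rfl⟩ := Finset.mem_image.1 hy
        simpa using hb
      have hdisj : Disjoint Y (X.image (z + ·)) := by
        rw [Finset.disjoint_right]
        intro a ha haY
        obtain ⟨x, hx, rfl⟩ := Finset.mem_image.1 ha
        exact hzY (by simpa using hsub x hx _ haY)
      have hind := indep (Y ∪ X.image (z + ·)) (by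
        intro a ha ha1
        simp only [Finset.mem_union, Finset.mem_image] at ha ha1
        rcases ha with ha | ⟨x, hx, rfl⟩ <;> rcases ha1 with ha1 | ⟨x', hx', h'⟩
        · exact hR a (hYR ha) (hYR ha1)
        · have h1 := hR _ (hYR (hsub x' hx' a ha))
          rw [show a - x' + 1 = z by linear_combination -h'] at h1
          exact h1 hzR
        · have h1 := hYR (hsub x hx _ ha1)
          rw [show z + x + 1 - x = z + 1 by ring] at h1
          exact hR z hzR h1
        · have h1 := hsub x hx _ (hclosed x' hx' 0 hY)
          rw [show x' + 0 - x = 0 + 1 by linear_combination h'] at h1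
          exact hR 0 (hYR hY) (hYR h1))
      rw [Finset.card_union_of_disjoint hdisj,
        Finset.card_image_of_injective _ (add_right_injective z)] at hind
      left
      omega
  · push Not at hclosed
    obtain ⟨x, hx, e, he, hxe⟩ := hclosed
    have hlt : (X.filter (· + e ∈ Y)).card < X.card :=
      Finset.card_lt_card (Finset.filter_ssubset.2 ⟨x, hx, hxe⟩)
    have hcard : (Y ∪ (X.filter (¬ · + e ∈ Y)).image (· + e)).card =
        Y.card + (X.filter (¬ · + e ∈ Y)).card := by
      rw [Finset.card_union_of_disjoint, Finset.card_image_of_injective _ (add_left_injective e)]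
      rw [Finset.disjoint_right]
      intro a ha
      obtain ⟨b, hb, rfl⟩ := Finset.mem_image.1 ha
      exact (Finset.mem_filter.1 hb).2
    have hsplit := Finset.card_filter_add_card_filter_not (s := X) (· + e ∈ Y)
    have := ih _ hlt (X.filter (· + e ∈ Y)) (Y ∪ (X.filter (¬ · + e ∈ Y)).image (· + e))
      (by simpa [hX] using he) (Finset.mem_union_left _ hY) (by
        intro a ha b hb
        rw [Finset.mem_filter] at ha
        rcases Finset.mem_union.1 hb with hb | hb
        · exact hXY a ha.1 b hb
        · obtain ⟨c, hc, rfl⟩ := Finset.mem_image.1 hb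
          rw [show a + (c + e) = c + (a + e) by ring]
          exact hXY c (Finset.mem_filter.1 hc).1 _ ha.2) rfl
    rw [hcard] at this
    refine this.imp_left fun h => ?_
    omega

/-- `H` is an additive submonoid of `ℕ` containing every integer above `F` but not `F`, and no two
consecutive integers below `F`. -/
structure IsSparseWithFrobenius (H : Set ℕ) (F : ℕ) : Prop where
  zero_mem : 0 ∈ H
  add_mem : ∀ a ∈ H, ∀ b ∈ H, a + b ∈ H
  frobenius_notMem : F ∉ H
  mem_of_lt : ∀ n, F < n → n ∈ H
  succ_notMem : ∀ n, n + 1 ≤ F → n ∈ H → n + 1 ∉ H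

open Classical in
/-- The number of elements of `H` smaller than `n`. -/
noncomputable def countBelow (H : Set ℕ) (n : ℕ) : ℕ := Nat.count (· ∈ H) n

theorem countBelow_succ_of_mem {H : Set ℕ} {n : ℕ} (h : n ∈ H) :
    countBelow H (n + 1) = countBelow H n + 1 := by
  simp [countBelow, Nat.count_succ, h]

theorem countBelow_succ_of_notMem {H : Set ℕ} {n : ℕ} (h : n ∉ H) :
    countBelow H (n + 1) = countBelow H n := by
  simp [countBelow, Nat.count_succ, h]

theorem countBelow_mono (H : Set ℕ) {a b : ℕ} (h : a ≤ b) : countBelow H a ≤ countBelow H b := by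
  classical exact Nat.count_monotone _ h

open Classical in
theorem card_filter_Ico_add_countBelow (H : Set ℕ) {a b : ℕ} (h : a ≤ b) :
    ((Finset.Ico a b).filter (· ∈ H)).card + countBelow H a = countBelow H b := by
  induction b, h using Nat.le_induction with
  | base => simp
  | succ b hab ih =>
    rw [← Finset.insert_Ico_right_eq_Ico_add_one hab, Finset.filter_insert]
    split_ifs with hb
    · rw [countBelow_succ_of_mem hb, Finset.card_insert_of_notMem (by simp)]
      omega
    · rw [countBelow_succ_of_notMem hb, ih]

theorem countBelow_lt_of_subset {H K : Set ℕ} (h : H ⊆ K) {t n : ℕ} (htn : t < n) (htK : t ∈ K)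
    (htH : t ∉ H) : countBelow H n < countBelow K n := by
  classical
  simp only [countBelow, Nat.count_eq_card_filter_range]
  apply Finset.card_lt_card
  rw [Finset.ssubset_iff_of_subset (Finset.monotone_filter_right _ fun x _ hx => h hx)]
  exact ⟨t, by simp [*], by simp [*]⟩

namespace IsSparseWithFrobenius

variable {H : Set ℕ} {F m : ℕ}

theorem mul_mem (h : IsSparseWithFrobenius H F) (hm : m ∈ H) (k : ℕ) : k * m ∈ H := by
  induction k with
  | zero => simpa using h.zero_mem
  | succ k ih => rw [Nat.succ_mul]; exact h.add_mem _ ih _ hm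

theorem mem_of_modEq (h : IsSparseWithFrobenius H F) (hm : m ∈ H) {a b : ℕ} (ha : a ∈ H)
    (hab : a ≤ b) (hmod : (a : ZMod m) = b) : b ∈ H := by
  rw [ZMod.natCast_eq_natCast_iff, Nat.modEq_iff_dvd' hab] at hmod
  obtain ⟨c, hc⟩ := hmod
  rw [show b = a + c * m by rw [mul_comm c]; omega]
  exact h.add_mem _ ha _ (h.mul_mem hm c)

theorem countBelow_add_two_mul_le (h : IsSparseWithFrobenius H F) (a k : ℕ)
    (hk : a + 2 * k ≤ F + 1) : countBelow H (a + 2 * k) ≤ countBelow H a + k := by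
  induction k with
  | zero => simp
  | succ k ih =>
    have := ih (by omega)
    rw [show a + 2 * (k + 1) = a + 2 * k + 1 + 1 by ring]
    by_cases h1 : a + 2 * k ∈ H
    · rw [countBelow_succ_of_notMem (h.succ_notMem _ (by omega) h1), countBelow_succ_of_mem h1]
      omega
    · by_cases h2 : a + 2 * k + 1 ∈ H
      · rw [countBelow_succ_of_mem h2, countBelow_succ_of_notMem h1]
        omega
      · rw [countBelow_succ_of_notMem h2, countBelow_succ_of_notMem h1]
        omega

open Classical in
/-- The residues modulo `m` of the elements of `H` in the interval `[a, b)`. -/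
noncomputable def residues (H : Set ℕ) (m a b : ℕ) : Finset (ZMod m) :=
  ((Finset.Ico a b).filter (· ∈ H)).image (↑)

theorem mem_residues {a b : ℕ} {z : ZMod m} :
    z ∈ residues H m a b ↔ ∃ n, (a ≤ n ∧ n < b) ∧ n ∈ H ∧ (n : ZMod m) = z := by
  simp [residues, and_assoc]

theorem card_residues {a b : ℕ} (hab : a ≤ b) (hb : b ≤ a + m) :
    (residues H m a b).card + countBelow H a = countBelow H b := by
  classical
  rw [residues, Finset.card_image_of_injOn, card_filter_Ico_add_countBelow H hab]
  intro x hx y hy hxy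
  simp only [Finset.coe_filter, Finset.mem_Ico, Set.mem_ofPred_eq] at hx hy
  rw [ZMod.natCast_eq_natCast_iff] at hxy
  rcases le_total x y with hle | hle
  · have h1 := (Nat.modEq_iff_dvd' hle).1 hxy
    have := Nat.eq_zero_of_dvd_of_lt h1 (by omega)
    omega
  · have h1 := (Nat.modEq_iff_dvd' hle).1 hxy.symm
    have := Nat.eq_zero_of_dvd_of_lt h1 (by omega)
    omega

theorem add_one_notMem_residues (h : IsSparseWithFrobenius H F) (hm : m ∈ H) :
    ∀ z ∈ residues H m 0 (F + 1), z + 1 ∉ residues H m 0 (F + 1) := by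
  intro z hz hz1
  obtain ⟨a, ⟨-, ha⟩, haH, rfl⟩ := mem_residues.1 hz
  obtain ⟨b, ⟨-, hb⟩, hbH, hab⟩ := mem_residues.1 hz1
  have haF : a ≠ F := fun h' => h.frobenius_notMem (h' ▸ haH)
  rcases Nat.lt_or_ge a b with hlt | hge
  · obtain ⟨c, rfl⟩ : ∃ c, b = c + 1 := ⟨b - 1, by omega⟩
    refine h.succ_notMem c (by omega) (h.mem_of_modEq hm haH (by omega) ?_) hbH
    push_cast at hab
    exact (add_right_cancel hab).symm
  · exact h.succ_notMem a (by omega) haH (h.mem_of_modEq hm hbH (by omega) (by rw [hab]; simp))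

theorem frobenius_notMem_residues (h : IsSparseWithFrobenius H F) (hm : m ∈ H) :
    (F : ZMod m) ∉ residues H m 0 (F + 1) := by
  intro hF
  obtain ⟨a, ⟨-, ha⟩, haH, hab⟩ := mem_residues.1 hF
  exact h.frobenius_notMem (h.mem_of_modEq hm haH (by omega) hab)

theorem zero_mem_residues (h : IsSparseWithFrobenius H F) (hm : m ∈ H) (hpos : 0 < m) (x : ℕ) :
    0 ∈ residues H m (x + 1 - m) (x + 1) := by
  refine mem_residues.2 ⟨x / m * m, ?_, h.mul_mem hm _, by simp⟩
  have := Nat.div_add_mod' x m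
  have := Nat.mod_lt x hpos
  omega

/-- Adjoining `t` to `H` keeps it sparse with the same Frobenius number if the residues of `H`
modulo `m` are invariant under translation by `t`. -/
theorem adjoin (h : IsSparseWithFrobenius H F) (hm : m ∈ H) (t : ℕ)
    (ht : ∀ z ∈ residues H m 0 (F + 1), z + t ∈ residues H m 0 (F + 1)) :
    IsSparseWithFrobenius {x | F < x ∨ ∃ a ∈ H, ∃ j, x = a + j * t} F := by
  have hres (a : ℕ) (ha : a ∈ H) (j : ℕ) (hle : a + j * t ≤ F) :
      ((a + j * t : ℕ) : ZMod m) ∈ residues H m 0 (F + 1) := by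
    have haR : (a : ZMod m) ∈ residues H m 0 (F + 1) :=
      mem_residues.2 ⟨a, ⟨by omega, by omega⟩, ha, rfl⟩
    clear hle
    induction j with
    | zero => simpa using haR
    | succ j ih =>
      have := ht _ ih
      push_cast at this ⊢
      rwa [add_mul, one_mul, ← add_assoc]
  refine ⟨Or.inr ⟨0, h.zero_mem, 0, by simp⟩, ?_, ?_, fun n hn => Or.inl hn, ?_⟩
  · rintro x (hx | ⟨a, ha, i, rfl⟩) y (hy | ⟨b, hb, j, rfl⟩)
    · exact Or.inl (by omega)
    · exact Or.inl (by omega)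
    · exact Or.inl (by omega)
    · exact Or.inr ⟨a + b, h.add_mem _ ha _ hb, i + j, by ring⟩
  · rintro (hx | ⟨a, ha, j, hj⟩)
    · omega
    · have := hres a ha j (by omega)
      rw [← hj] at this
      exact h.frobenius_notMem_residues hm this
  · rintro n hn (hx | ⟨a, ha, i, hi⟩) (hy | ⟨b, hb, j, hj⟩)
    · omega
    · omega
    · omega
    · have h1 := hres a ha i (by omega)
      have h2 := hres b hb j (by omega)
      rw [← hi] at h1
      rw [← hj] at h2
      push_cast at h2
      exact h.add_one_notMem_residues hm _ h1 h2

/-- If the residues of `H` modulo its odd multiplicity are periodic, then `H` is properly contained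
in such a set of smaller odd multiplicity. -/
theorem exists_larger (h : IsSparseWithFrobenius H F) (hodd : Odd m) (hm : m ∈ H) (hmF : m ≤ F)
    (hmin : ∀ n ∈ H, 0 < n → m ≤ n) {s : ZMod m} (hs0 : s ≠ 0)
    (hs : ∀ z ∈ residues H m 0 (F + 1), z + s ∈ residues H m 0 (F + 1)) :
    ∃ t < m, Odd t ∧ ∃ K, IsSparseWithFrobenius K F ∧ t ∈ K ∧ (∀ n ∈ K, 0 < n → t ≤ n) ∧
      countBelow H (F + 1) < countBelow K (F + 1) := by
  have hpos : 0 < m := hodd.pos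
  have : NeZero m := ⟨hpos.ne'⟩
  have hval : s.val ≠ 0 := by rwa [Ne, ZMod.val_eq_zero]
  set t := Nat.gcd s.val m with ht_def
  have ht0 : 0 < t := Nat.gcd_pos_of_pos_right _ hpos
  have htm : t < m := (Nat.gcd_le_left _ (Nat.pos_of_ne_zero hval)).trans_lt s.val_lt
  have htodd : Odd t := hodd.of_dvd_nat (Nat.gcd_dvd_right _ _)
  obtain ⟨c, hc⟩ : ∃ c : ℕ, (t : ZMod m) = c * s := by
    refine ⟨(Nat.gcdA s.val m : ZMod m).val, ?_⟩
    have hbez := congrArg (Int.cast : ℤ → ZMod m) (Nat.gcd_eq_gcd_ab s.val m)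
    push_cast at hbez
    rw [ZMod.natCast_self, ZMod.natCast_zmod_val] at hbez
    rw [ZMod.natCast_zmod_val, ht_def, hbez]
    ring
  have htR : ∀ z ∈ residues H m 0 (F + 1), z + t ∈ residues H m 0 (F + 1) := by
    intro z hz
    rw [hc]
    clear hc
    induction c with
    | zero => simpa using hz
    | succ c ih =>
      have := hs _ ih
      push_cast
      rwa [add_mul, one_mul, ← add_assoc]
  have htK : t ∈ {x | F < x ∨ ∃ a ∈ H, ∃ j, x = a + j * t} :=
    Or.inr ⟨0, h.zero_mem, 1, by simp⟩
  refine ⟨t, htm, htodd, _, h.adjoin hm t htR, htK, ?_,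
    countBelow_lt_of_subset (fun x hx => Or.inr ⟨x, hx, 0, by simp⟩) (by omega) htK ?_⟩
  · rintro n (hn | ⟨a, ha, j, rfl⟩) hn0
    · omega
    · rcases Nat.eq_zero_or_pos a with rfl | ha0
      · rcases Nat.eq_zero_or_pos j with rfl | hj0
        · simp at hn0
        · have := Nat.le_mul_of_pos_left t hj0
          omega
      · have := hmin a ha ha0
        omega
  · intro htH
    have := hmin t htH ht0
    omega

/-- If the residues of `H` modulo `m` are not periodic, two windows of length `m` whose right ends
add up to at most `F` contain together at most `(m + 1) / 2` elements of `H`. -/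
theorem windows_le (h : IsSparseWithFrobenius H F) (hodd : Odd m) (hm : m ∈ H)
    (hper : ¬ ∃ s : ZMod m, s ≠ 0 ∧
      ∀ z ∈ residues H m 0 (F + 1), z + s ∈ residues H m 0 (F + 1))
    {x y : ℕ} (hxy : x + y ≤ F) :
    2 * (countBelow H (x + 1) + countBelow H (y + 1)) ≤
      m + 1 + 2 * (countBelow H (x + 1 - m) + countBelow H (y + 1 - m)) := by
  have hpos : 0 < m := hodd.pos
  have : NeZero m := ⟨hpos.ne'⟩
  have key := (ZMod.card_add_card_le_or_periodic hodd _ (h.add_one_notMem_residues hm)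
    (residues H m (x + 1 - m) (x + 1)) (residues H m (y + 1 - m) (y + 1))
    (h.zero_mem_residues hm hpos x) (h.zero_mem_residues hm hpos y) (by
      intro a ha b hb
      obtain ⟨a, ⟨-, ha⟩, haH, rfl⟩ := mem_residues.1 ha
      obtain ⟨b, ⟨-, hb⟩, hbH, rfl⟩ := mem_residues.1 hb
      exact mem_residues.2 ⟨a + b, ⟨by omega, by omega⟩, h.add_mem _ haH _ hbH, by simp⟩)
    ).resolve_right hper
  have := card_residues (H := H) (m := m) (a := x + 1 - m) (b := x + 1) (by omega) (by omega)
  have := card_residues (H := H) (m := m) (a := y + 1 - m) (b := y + 1) (by omega) (by omega)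
  omega

/-- The sum of the window estimates over `k = 0, …, p`, where `F = p * m + f`. -/
theorem sum_windows_le (h : IsSparseWithFrobenius H F) (hodd : Odd m) (hm : m ∈ H)
    (hper : ¬ ∃ s : ZMod m, s ≠ 0 ∧
      ∀ z ∈ residues H m 0 (F + 1), z + s ∈ residues H m 0 (F + 1))
    {p f : ℕ} (hF : F = p * m + f) (hf : f < m) :
    2 * (countBelow H (F + 1) + countBelow H (p * m + 1)) ≤ (p + 1) * (m + 1) := by
  have hpos : 0 < m := hodd.pos
  have step : ∀ k ≤ p, 2 * (countBelow H (k * m + f + 1) + countBelow H (p * m + 1)) ≤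
      (k + 1) * (m + 1) + 2 * countBelow H ((p - k) * m + 1 - m) := by
    intro k
    induction k with
    | zero =>
      intro _
      have := h.windows_le hodd hm hper (x := f) (y := p * m) (by omega)
      rw [show f + 1 - m = 0 by omega] at this
      simpa [countBelow] using this
    | succ k ih =>
      intro hk
      have h1 := ih (by omega)
      obtain ⟨q, rfl⟩ : ∃ q, p = q + (k + 1) := ⟨p - (k + 1), by omega⟩
      have h2 := h.windows_le hodd hm hper (x := (k + 1) * m + f) (y := q * m)
        (by rw [hF]; nlinarith)
      rw [show (k + 1) * m + f + 1 - m = k * m + f + 1 by rw [Nat.succ_mul]; omega] at h2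
      rw [show q + (k + 1) - k = q + 1 by omega,
        show (q + 1) * m + 1 - m = q * m + 1 by rw [Nat.succ_mul]; omega] at h1
      rw [show q + (k + 1) - (k + 1) = q by omega]
      nlinarith
  have := step p le_rfl
  rw [hF]
  rw [show (p - p) * m + 1 - m = 0 by simp; omega] at this
  simpa [countBelow] using this

theorem countBelow_multiplicity (h : IsSparseWithFrobenius H F) (hpos : 0 < m)
    (hmin : ∀ n ∈ H, 0 < n → m ≤ n) : countBelow H m = 1 := by
  induction m, Nat.succ_le_of_lt hpos using Nat.le_induction with
  | base => rw [countBelow_succ_of_mem h.zero_mem]; simp [countBelow]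
  | succ m hm ih =>
    rw [countBelow_succ_of_notMem fun hmH => by have := hmin m hmH hm; omega]
    exact ih hm fun n hn hn0 => by have := hmin n hn hn0; omega

/-- If the intervals `[m, 2m - 1)` and `[2m, 3m - 2)` contain as many elements of `H` as
sparseness allows, then those are the elements at even distance from the left end. -/
theorem mem_iff_of_tight {q : ℕ} (h : IsSparseWithFrobenius H F) (hm : m ∈ H)
    (hmin : ∀ n ∈ H, 0 < n → m ≤ n) (hq : m = 2 * q + 1) (hq0 : 0 < q) (hF : F + 2 = 3 * m)
    (hN : 2 * q + 1 ≤ countBelow H F) (n : ℕ) (hn : n ≤ F) :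
    n ∈ H ↔ n = 0 ∨ ∃ j < q, n = m + 2 * j ∨ n = 2 * m + 2 * j := by
  have h2m : 2 * m ∈ H := h.mul_mem hm 2
  have hcm := h.countBelow_multiplicity (by omega) hmin
  have hpred : 2 * m - 1 ∉ H := fun h' =>
    h.succ_notMem _ (by omega) h' (by rwa [show 2 * m - 1 + 1 = 2 * m by omega])
  have hpred' := countBelow_succ_of_notMem hpred
  rw [show 2 * m - 1 + 1 = 2 * m by omega] at hpred'
  have hX := h.countBelow_add_two_mul_le m q (by omega)
  rw [show m + 2 * q = 2 * m - 1 by omega] at hX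
  have hY0 : ∀ j < q, 2 * m + 2 * j ∈ H := by
    intro j hj
    by_contra hnot
    have h1 := h.countBelow_add_two_mul_le (2 * m) j (by omega)
    have h2 := h.countBelow_add_two_mul_le (2 * m + 2 * j + 1) (q - 1 - j) (by omega)
    rw [countBelow_succ_of_notMem hnot,
      show 2 * m + 2 * j + 1 + 2 * (q - 1 - j) = F by omega] at h2
    omega
  have hY1 : ∀ j < q, 2 * m + 2 * j + 1 ∉ H := fun j hj =>
    h.succ_notMem _ (by omega) (hY0 j hj)
  have hX1 : ∀ j < q, m + 2 * j + 1 ∉ H := fun j hj hmem =>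
    hY1 j hj (by
      rw [show 2 * m + 2 * j + 1 = m + (m + 2 * j + 1) by ring]
      exact h.add_mem _ hm _ hmem)
  have hYle := h.countBelow_add_two_mul_le (2 * m) q (by omega)
  have hFs := countBelow_succ_of_notMem h.frobenius_notMem
  rw [show 2 * m + 2 * q = F + 1 by omega] at hYle
  have hX0 : ∀ j < q, m + 2 * j ∈ H := by
    intro j hj
    by_contra hnot
    have h1 := h.countBelow_add_two_mul_le m j (by omega)
    have h2 := h.countBelow_add_two_mul_le (m + 2 * j + 1 + 1) (q - 1 - j) (by omega)
    rw [countBelow_succ_of_notMem (hX1 j hj), countBelow_succ_of_notMem hnot,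
      show m + 2 * j + 1 + 1 + 2 * (q - 1 - j) = 2 * m - 1 by omega] at h2
    omega
  constructor
  · intro hnH
    rcases Nat.eq_zero_or_pos n with rfl | hn0
    · exact Or.inl rfl
    right
    have hmn := hmin n hnH hn0
    rcases Nat.lt_or_ge n (2 * m) with hlt | hge
    · obtain ⟨j, hj | hj⟩ : ∃ j, n = m + 2 * j ∨ n = m + 2 * j + 1 :=
        ⟨(n - m) / 2, by omega⟩
      · refine ⟨j, ?_, Or.inl hj⟩
        by_contra hjq
        exact hpred (by rwa [show 2 * m - 1 = n by omega])
      · exact absurd (hj ▸ hnH) (hX1 j (by omega))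
    · obtain ⟨j, hj | hj⟩ : ∃ j, n = 2 * m + 2 * j ∨ n = 2 * m + 2 * j + 1 :=
        ⟨(n - 2 * m) / 2, by omega⟩
      · exact ⟨j, by omega, Or.inr hj⟩
      · exact absurd (hj ▸ hnH) (hY1 j (by omega))
  · rintro (rfl | ⟨j, hj, rfl | rfl⟩)
    · exact h.zero_mem
    · exact hX0 j hj
    · exact hY0 j hj

/-- A sparse set of odd multiplicity and odd Frobenius number `F` contains at most `(F + 2) / 3`
elements below `F`, and the sets attaining the bound are known. -/
theorem structure_of_odd_multiplicity (h : IsSparseWithFrobenius H F) (hFodd : Odd F)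
    (hodd : Odd m) (hm : m ∈ H) (hmin : ∀ n ∈ H, 0 < n → m ≤ n)
    (hN : F + 2 ≤ 3 * countBelow H (F + 1)) :
    3 * countBelow H (F + 1) = F + 2 ∧ (m = 3 ∨ F + 2 = 3 * m ∧ 5 ≤ m ∧ ∀ n ≤ F,
      (n ∈ H ↔ n = 0 ∨ ∃ j < m / 2, n = m + 2 * j ∨ n = 2 * m + 2 * j)) := by
  induction m using Nat.strong_induction_on generalizing H with
  | _ m ih =>
  have hpos := hodd.pos
  have hm1 : m ≠ 1 := by
    rintro rfl
    exact h.frobenius_notMem (by simpa using h.mul_mem hm F)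
  have hmF : m ≤ F := by
    have := hmin (F + 1) (h.mem_of_lt _ (by omega)) (by omega)
    obtain ⟨a, ha⟩ := hodd
    obtain ⟨b, hb⟩ := hFodd
    omega
  by_cases hper : ∃ s : ZMod m, s ≠ 0 ∧
      ∀ z ∈ residues H m 0 (F + 1), z + s ∈ residues H m 0 (F + 1)
  · obtain ⟨s, hs0, hs⟩ := hper
    obtain ⟨t, htm, htodd, K, hK, htK, hKmin, hlt⟩ := h.exists_larger hodd hm hmF hmin hs0 hs
    have := (ih t htm hK htodd htK hKmin (by omega)).1
    omega
  obtain ⟨p, f, hpf, hf⟩ : ∃ p f, F = p * m + f ∧ f < m :=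
    ⟨F / m, F % m, (Nat.div_add_mod' F m).symm, Nat.mod_lt _ hpos⟩
  have hpm := h.mul_mem hm p
  have hf0 : f ≠ 0 := by
    rintro rfl
    exact h.frobenius_notMem (by rw [hpf]; exact hpm)
  have hsum := h.sum_windows_le hodd hm hper hpf hf
  have hFs := countBelow_succ_of_notMem h.frobenius_notMem
  have htop : 2 * countBelow H (F + 1) ≤ 2 * countBelow H (p * m + 1) + (f - 1) := by
    have hnext : p * m + 1 ∉ H := h.succ_notMem _ (by omega) hpm
    have h1 := countBelow_succ_of_notMem hnext
    have h2 := h.countBelow_add_two_mul_le (p * m + 1 + 1) ((f - 1) / 2) (by omega)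
    have h3 := countBelow_mono H
      (show F ≤ p * m + 1 + 1 + 2 * ((f - 1) / 2) by omega)
    omega
  have hmain : p * m + 9 + f ≤ 3 * p + 3 * m + 1 := by
    rw [show (p + 1) * (m + 1) = p * m + p + m + 1 by ring] at hsum
    omega
  obtain ⟨q, hq⟩ := hodd
  obtain ⟨u, hu⟩ := hFodd
  have hcm := h.countBelow_multiplicity hpos hmin
  by_cases hm3 : m = 3
  · refine ⟨?_, Or.inl hm3⟩
    subst hm3
    omega
  have hp : p = 1 ∨ p = 2 := by
    have hp3 : p ≤ 3 := by
      by_contra hp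
      obtain ⟨a, rfl⟩ : ∃ a, p = 4 + a := ⟨p - 4, by omega⟩
      obtain ⟨b, rfl⟩ : ∃ b, m = 5 + b := ⟨m - 5, by omega⟩
      rw [show (4 + a) * (5 + b) = 20 + 5 * a + 4 * b + a * b by ring] at hmain
      omega
    interval_cases p <;> omega
  rcases hp with rfl | rfl
  · have h1 := h.countBelow_add_two_mul_le m (f / 2) (by omega)
    rw [show m + 2 * (f / 2) = F by omega] at h1
    omega
  · have hpred : 2 * m - 1 ∉ H := fun h' =>
      h.succ_notMem _ (by omega) h' (by rwa [show 2 * m - 1 + 1 = 2 * m by omega])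
    have hpred' := countBelow_succ_of_notMem hpred
    rw [show 2 * m - 1 + 1 = 2 * m by omega] at hpred'
    have hX := h.countBelow_add_two_mul_le m q (by omega)
    rw [show m + 2 * q = 2 * m - 1 by omega] at hX
    have hY := h.countBelow_add_two_mul_le (2 * m) ((f + 1) / 2) (by omega)
    rw [show 2 * m + 2 * ((f + 1) / 2) = F + 1 by omega] at hY
    refine ⟨by omega, Or.inr ⟨by omega, by omega, ?_⟩⟩
    rw [show m / 2 = q by omega]
    exact h.mem_iff_of_tight hm hmin hq (by omega) (by omega) (by omega)

end IsSparseWithFrobenius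

/-- A sparse numerical semigroup of genus `g` satisfies `IsSparseWithFrobenius` with respect to its
last gap, and it has `gap H g + 1 - g` elements below it. -/
theorem IsSparse.isSparseWithFrobenius {H : Set ℕ} {g : ℕ} (hg : 0 < g)
    (hH : IsNumericalSemigroupOfGenus H g) (hs : IsSparse H g) :
    IsSparseWithFrobenius H (gap H g) ∧ countBelow H (gap H g + 1) + g = gap H g + 1 := by
  classical
  obtain ⟨h0, hadd, hfin, hcard⟩ := hH
  have hfin' : {n | n ∉ H}.Finite := hfin
  have hcard' : hfin'.toFinset.card = g := by
    rw [← hcard, Set.ncard_eq_toFinset_card _ hfin]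
  have hlt (i : ℕ) (hi : i < g) : ∀ hf : {n | n ∉ H}.Finite, i < hf.toFinset.card :=
    fun _ => by rw [hcard']; exact hi
  have hnot (i : ℕ) (hi : i < g) : Nat.nth (fun n => n ∉ H) i ∉ H := Nat.nth_mem i (hlt i hi)
  have hF : gap H g ∉ H := hnot _ (by omega)
  have hcF : Nat.count (fun n => n ∉ H) (gap H g) = g - 1 :=
    Nat.count_nth (hlt _ (by omega))
  have hcF1 : Nat.count (fun n => n ∉ H) (gap H g + 1) = g := by
    rw [Nat.count_succ, if_pos hF, hcF]
    omega
  refine ⟨⟨h0, hadd, hF, ?_, ?_⟩, ?_⟩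
  · intro n hn
    by_contra hnH
    have h1 : Nat.count (fun n => n ∉ H) (n + 1) ≤ g := by
      rw [Nat.count_eq_card_filter_range, ← hcard']
      exact Finset.card_le_card fun x hx => hfin'.mem_toFinset.2 (Finset.mem_filter.1 hx).2
    rw [Nat.count_succ, if_pos hnH] at h1
    have h2 := Nat.count_monotone (fun n => n ∉ H) (show gap H g + 1 ≤ n from hn)
    omega
  · intro n hn hnH hn1
    have hone : 1 ∉ H := by
      intro h1
      have hall (k : ℕ) : k ∈ H := by
        induction k with
        | zero => exact h0
        | succ k ih => exact hadd _ ih _ h1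
      exact hF (hall _)
    have hnn : 2 ≤ n := by
      rcases n with _ | _ | n
      · exact absurd hn1 hone
      · exact absurd hnH hone
      · omega
    set c := Nat.count (fun n => n ∉ H) n with hc
    have hc1 : 1 ≤ c := by
      have h1 := Nat.count_monotone (fun n => n ∉ H) hnn
      have h2 : Nat.count (fun n => n ∉ H) 2 = 1 := by
        simp [Nat.count_succ, h0, hone]
      omega
    have hcg : c ≤ g - 1 := by
      rw [← hcF]
      exact Nat.count_monotone _ (by omega)
    have hgap := hs c hc1 hcg
    have hlow : gap H c < n := Nat.nth_lt_of_lt_count (by omega)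
    have hmem : gap H (c + 1) ∉ H := hnot c (by omega)
    have hhigh : n ≤ gap H (c + 1) := by
      by_contra hlt'
      have h3 : Nat.count (fun n => n ∉ H) (gap H (c + 1) + 1) ≤ c :=
        Nat.count_monotone _ (by omega)
      have h4 : Nat.count (fun n => n ∉ H) (gap H (c + 1)) = c := Nat.count_nth (hlt c (by omega))
      rw [Nat.count_succ, if_pos hmem] at h3
      omega
    have h5 : gap H (c + 1) ≠ n := fun h' => hmem (h' ▸ hnH)
    have h6 : gap H (c + 1) ≠ n + 1 := fun h' => hmem (h' ▸ hn1)
    omega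
  · have hsplit := Finset.card_filter_add_card_filter_not
      (s := Finset.range (gap H g + 1)) (· ∈ H)
    rw [Nat.count_eq_card_filter_range] at hcF1
    rw [hcF1, Finset.card_range] at hsplit
    rw [countBelow, Nat.count_eq_card_filter_range]
    exact hsplit

/-- **Theorem.** Let `H` be a limit sparse numerical semigroup with odd Frobenius
number `ℓ_g = 2g - (2r+1) = 6r + 1`. If the multiplicity of `H` is odd, then `H` is
one of the following:
(1) `H = 3ℕ + H_{6r+1} = {3k : 3k ≤ 6r} ∪ {n ≥ 6r + 2}`;
(2) `r > 1` and
`H = {0} ∪ {2j+1 : r ≤ j ≤ 2r-1} ∪ {2j : 2r+1 ≤ j ≤ 3r} ∪ {n ≥ 6r + 2}`. -/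
theorem odd_frobenius_odd_multiplicity (H : Set ℕ) (g r : ℕ) (hg : 1 < g)
    (hH : IsNumericalSemigroupOfGenus H g) (hs : IsSparse H g)
    (hlim : numSingle H g = numDouble H g)
    (hF : gap H g = 2 * g - (2 * r + 1)) (hF' : gap H g = 6 * r + 1)
    (hmult : Odd (multOf H)) :
    H = {n : ℕ | ∃ k, n = 3 * k ∧ 3 * k ≤ 6 * r} ∪ {n : ℕ | 6 * r + 2 ≤ n} ∨
    (1 < r ∧
      H = ({0} : Set ℕ) ∪
          {n : ℕ | ∃ j, n = 2 * j + 1 ∧ r ≤ j ∧ j ≤ 2 * r - 1} ∪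
          {n : ℕ | ∃ j, n = 2 * j ∧ 2 * r + 1 ≤ j ∧ j ≤ 3 * r} ∪
          {n : ℕ | 6 * r + 2 ≤ n}) := by
  obtain ⟨h, hcount⟩ := hs.isSparseWithFrobenius (by omega) hH
  rw [hF'] at h hcount
  have hne : {n : ℕ | n ∈ H ∧ 0 < n}.Nonempty :=
    ⟨6 * r + 2, h.mem_of_lt _ (by omega), by omega⟩
  have hm : multOf H ∈ H := (Nat.sInf_mem hne).1
  have hmin : ∀ n ∈ H, 0 < n → multOf H ≤ n := fun n hn hn0 => Nat.sInf_le ⟨hn, hn0⟩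
  obtain ⟨-, h3 | ⟨hmr, hm5, hiff⟩⟩ :=
    h.structure_of_odd_multiplicity ⟨3 * r, by ring⟩ hmult hm hmin (by omega)
  · left
    rw [h3] at hm
    ext n
    simp only [Set.mem_union, Set.mem_ofPred_eq]
    constructor
    · intro hn
      by_contra hcon
      push Not at hcon
      obtain ⟨hcon, hlt⟩ := hcon
      have hnF : n ≠ 6 * r + 1 := fun h' => h.frobenius_notMem (h' ▸ hn)
      rcases (show n % 3 = 0 ∨ n % 3 = 1 ∨ n % 3 = 2 by omega) with h0 | h1 | h2
      · have := hcon (n / 3) (by omega)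
        omega
      · refine h.frobenius_notMem ?_
        rw [show 6 * r + 1 = n + (6 * r + 1 - n) / 3 * 3 by omega]
        exact h.add_mem _ hn _ (h.mul_mem hm _)
      · refine h.succ_notMem n (by omega) hn ?_
        rw [show n + 1 = (n + 1) / 3 * 3 by omega]
        exact h.mul_mem hm _
    · rintro (⟨k, rfl, -⟩ | hn)
      · rw [mul_comm]
        exact h.mul_mem hm k
      · exact h.mem_of_lt n hn
  · right
    refine ⟨by omega, ?_⟩
    rw [show multOf H / 2 = r by omega, show multOf H = 2 * r + 1 by omega] at hiff
    ext n
    simp only [Set.mem_union, Set.mem_ofPred_eq, Set.mem_singleton_iff]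
    constructor
    · intro hn
      rcases Nat.lt_or_ge (6 * r + 1) n with hlt | hle
      · exact Or.inr hlt
      · left
        rcases (hiff n hle).1 hn with rfl | ⟨j, hj, rfl | rfl⟩
        · exact Or.inl (Or.inl rfl)
        · exact Or.inl (Or.inr ⟨r + j, by omega, by omega, by omega⟩)
        · exact Or.inr ⟨2 * r + 1 + j, by omega, by omega, by omega⟩
    · rintro (((rfl | ⟨j, rfl, hj1, hj2⟩) | ⟨j, rfl, hj1, hj2⟩) | hn)
      · exact h.zero_mem
      · exact (hiff _ (by omega)).2 (Or.inr ⟨j - r, by omega, Or.inl (by omega)⟩)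
      · exact (hiff _ (by omega)).2 (Or.inr ⟨j - (2 * r + 1), by omega, Or.inr (by omega)⟩)
      · exact h.mem_of_lt n hn
end

section
/- Let H be a sparse numerical semigroup of genus g > 1 with odd Frobenius number ℓ_g = 2g - (2r + 1). Then either g ≤ 4r + 1, or every element of H smaller than ℓ_g is even. -/
open Classical in
/-- A set of naturals closed under addition that misses `n - 1` and every
`n + 2 * i` with `i ≤ k`, contains every `n + 2 * i + 1` with `i < k`, has no two consecutive
elements below `n + 2 * k`, and contains no even number in `[2, 2 * k]`, has at most
`(n + 2 * k + 2) / 3` elements below `n + 2 * k`. -/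
theorem three_mul_card_le_of_run {H : Set ℕ} {n k : ℕ}
    (hadd : ∀ a ∈ H, ∀ b ∈ H, a + b ∈ H)
    (hsp : ∀ u ∈ H, u < n + 2 * k → u + 1 ∉ H) (hn : n - 1 ∉ H)
    (hgap : ∀ i ≤ k, n + 2 * i ∉ H) (hmem : ∀ i < k, n + 2 * i + 1 ∈ H)
    (heven : ∀ l, 1 ≤ l → l ≤ k → 2 * l ∉ H) :
    3 * ((Finset.range (n + 2 * k)).filter (· ∈ H)).card ≤ n + 2 * k + 2 := by
  have hn0 : n ∉ H := by simpa using hgap 0 (Nat.zero_le k)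
  set A := (Finset.range (n + 2 * k)).filter (· ∈ H) with hA
  set B := (Finset.range n).filter (· ∈ H) with hB
  set G := (Finset.range (n + 2 * k + 1)).filter (fun u => u ∉ H ∧ u - 1 ∉ H) with hG
  have hpart : A.card + A.card + G.card ≤ n + 2 * k + 1 := by
    have hc : (A.image (· + 1)).card = A.card :=
      Finset.card_image_of_injective _ (add_left_injective 1)
    have d1 : Disjoint A (A.image (· + 1)) := by
      rw [Finset.disjoint_left]
      intro u hu hu'
      obtain ⟨v, hv, rfl⟩ := Finset.mem_image.1 hu'
      simp only [hA, Finset.mem_filter, Finset.mem_range] at hu hv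
      exact hsp v hv.2 hv.1 hu.2
    have d2 : Disjoint (A ∪ A.image (· + 1)) G := by
      rw [Finset.disjoint_left]
      intro u hu hu'
      simp only [hG, Finset.mem_filter] at hu'
      rcases Finset.mem_union.1 hu with hu | hu
      · exact hu'.2.1 (Finset.mem_filter.1 hu).2
      · obtain ⟨v, hv, rfl⟩ := Finset.mem_image.1 hu
        exact hu'.2.2 (by simpa using (Finset.mem_filter.1 hv).2)
    have hsub : (A ∪ A.image (· + 1)) ∪ G ⊆ Finset.range (n + 2 * k + 1) := by
      intro u hu
      simp only [hA, hG, Finset.mem_union, Finset.mem_image, Finset.mem_filter,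
        Finset.mem_range] at hu ⊢
      rcases hu with (hu | ⟨v, hv, rfl⟩) | hu <;> omega
    have := Finset.card_le_card hsub
    rw [Finset.card_union_of_disjoint d2, Finset.card_union_of_disjoint d1, hc,
      Finset.card_range] at this
    exact this
  have hAB : A.card ≤ B.card + k := by
    have hsub : A ⊆ B ∪ (Finset.range k).image (fun i => n + 2 * i + 1) := by
      intro u hu
      simp only [hA, hB, Finset.mem_union, Finset.mem_image, Finset.mem_filter,
        Finset.mem_range] at hu ⊢
      by_cases hun : u < n
      · exact Or.inl ⟨hun, hu.2⟩
      · right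
        obtain ⟨i, hi | hi⟩ := Nat.even_or_odd' (u - n)
        · exact absurd (by rw [show n + 2 * i = u by omega]; exact hu.2) (hgap i (by omega))
        · exact ⟨i, by omega, by omega⟩
    calc A.card ≤ _ := Finset.card_le_card hsub
      _ ≤ _ := Finset.card_union_le _ _
      _ ≤ B.card + k := by
        gcongr
        exact Finset.card_image_le.trans (by simp)
  have hGB : B.card + (k - 1) ≤ G.card := by
    let φ : ℕ → ℕ := fun l => if 2 * l ≤ n ∧ n - 2 * l ∈ H then 2 * l + 1 else 2 * l
    have hφ : ∀ l, φ l = 2 * l ∨ φ l = 2 * l + 1 := by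
      intro l; dsimp only [φ]; split_ifs <;> simp
    have c1 : (B.image (n - ·)).card = B.card := by
      apply Finset.card_image_of_injOn
      intro a ha b hb hab
      simp only [hB, Finset.coe_filter, Finset.mem_range, Set.mem_ofPred_eq] at ha hb
      dsimp only at hab
      omega
    have c2 : ((Finset.Ico 1 k).image φ).card = k - 1 := by
      rw [Finset.card_image_of_injective, Nat.card_Ico]
      intro a b hab
      have := hφ a
      have := hφ b
      omega
    have hd : Disjoint (B.image (n - ·)) ((Finset.Ico 1 k).image φ) := by
      rw [Finset.disjoint_left]
      intro u hu hu'
      obtain ⟨a, ha, rfl⟩ := Finset.mem_image.1 hu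
      obtain ⟨l, hl, hla⟩ := Finset.mem_image.1 hu'
      simp only [hB, Finset.mem_filter, Finset.mem_range] at ha
      dsimp only [φ] at hla
      split_ifs at hla with hc
      · refine hsp a ha.2 (by omega) ?_
        rw [show a + 1 = n - 2 * l by omega]
        exact hc.2
      · exact hc ⟨by omega, by rw [show n - 2 * l = a by omega]; exact ha.2⟩
    have hsub : B.image (n - ·) ∪ (Finset.Ico 1 k).image φ ⊆ G := by
      intro u hu
      rcases Finset.mem_union.1 hu with hu | hu
      · obtain ⟨a, ha, rfl⟩ := Finset.mem_image.1 hu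
        simp only [hB, Finset.mem_filter, Finset.mem_range] at ha
        simp only [hG, Finset.mem_filter, Finset.mem_range]
        refine ⟨by omega, fun h => hn0 ?_, fun h => hn ?_⟩
        · have := hadd _ h _ ha.2
          rwa [show n - a + a = n by omega] at this
        · have := hadd _ h _ ha.2
          rwa [show n - a - 1 + a = n - 1 by omega] at this
      · obtain ⟨l, hl, rfl⟩ := Finset.mem_image.1 hu
        rw [Finset.mem_Ico] at hl
        have hn1 : n + 1 ∈ H := by simpa using hmem 0 (by omega)
        have e0 : 2 * l ∉ H := heven l hl.1 (by omega)
        have e1 : 2 * l - 1 ∉ H := fun h => hgap l (by omega) (by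
          have := hadd _ hn1 _ h
          rwa [show n + 1 + (2 * l - 1) = n + 2 * l by omega] at this)
        have e2 : 2 * l + 1 ∉ H := fun h => hgap (l + 1) (by omega) (by
          have := hadd _ hn1 _ h
          rwa [show n + 1 + (2 * l + 1) = n + 2 * (l + 1) by omega] at this)
        simp only [hG, Finset.mem_filter, Finset.mem_range]
        rcases hφ l with h | h <;> rw [h]
        · exact ⟨by omega, e0, e1⟩
        · exact ⟨by omega, e2, by simpa using e0⟩
    have := Finset.card_le_card hsub
    rwa [Finset.card_union_of_disjoint hd, c1, c2] at this
  omega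

open Classical in
/-- A set of naturals closed under addition, missing the odd number `F`, with no
two consecutive elements below `F` but with an odd element below `F`, has at most `(F + 2) / 3`
elements below `F`. -/
theorem three_mul_card_le_of_odd_mem {H : Set ℕ} {F h : ℕ}
    (hadd : ∀ a ∈ H, ∀ b ∈ H, a + b ∈ H) (hF : F ∉ H) (hFodd : Odd F)
    (hsp : ∀ u ∈ H, u < F → u + 1 ∉ H) (hh : h ∈ H) (hhodd : Odd h) (hhF : h < F) :
    3 * ((Finset.range F).filter (· ∈ H)).card ≤ F + 2 := by
  obtain ⟨a, ha⟩ := hFodd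
  obtain ⟨b, hb⟩ := hhodd
  have hex : ∃ j, F - 2 * j - 1 ∉ H := by
    refine ⟨a - b, fun hm => hsp _ hm (by omega) ?_⟩
    rwa [show F - 2 * (a - b) - 1 + 1 = h by omega]
  obtain ⟨k, hk, hmin⟩ : ∃ k, F - 2 * k - 1 ∉ H ∧ ∀ j < k, F - 2 * j - 1 ∈ H :=
    ⟨Nat.find hex, Nat.find_spec hex, fun j hj => not_not.1 (Nat.find_min hex hj)⟩
  have hgap : ∀ j ≤ k, 2 * j ≤ F → F - 2 * j ∉ H := by
    intro j hj hjF hm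
    rcases Nat.eq_zero_or_pos j with rfl | hj0
    · exact hF hm
    · refine hsp _ hm (by omega) ?_
      have := hmin (j - 1) (by omega)
      rwa [show F - 2 * (j - 1) - 1 = F - 2 * j + 1 by omega] at this
  have hkb : k < a - b := by
    by_contra hc
    exact hgap (a - b) (by omega) (by omega) (by rwa [show F - 2 * (a - b) = h by omega])
  obtain ⟨n, rfl⟩ : ∃ n, F = n + 2 * k := ⟨F - 2 * k, by omega⟩
  have hgap' : ∀ i ≤ k, n + 2 * i ∉ H := by
    intro i hi
    have := hgap (k - i) (by omega) (by omega)
    rwa [show n + 2 * k - 2 * (k - i) = n + 2 * i by omega] at this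
  refine three_mul_card_le_of_run hadd hsp ?_ hgap' ?_ ?_
  · rwa [show n + 2 * k - 2 * k - 1 = n - 1 by omega] at hk
  · intro i hi
    have := hmin (k - 1 - i) (by omega)
    rwa [show n + 2 * k - 2 * (k - 1 - i) - 1 = n + 2 * i + 1 by omega] at this
  · intro l hl hlk hm
    have key : ∀ d t, t ∈ H → t + 2 * d = n → False := by
      intro d
      induction d using Nat.strong_induction_on with
      | _ d ih =>
        intro t ht htd
        have h2 := hadd _ ht _ hm
        by_cases hdl : l ≤ d
        · exact ih (d - l) (by omega) _ h2 (by omega)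
        · refine hgap' (l - d) (by omega) ?_
          rwa [show n + 2 * (l - d) = t + 2 * l by omega]
    exact key (a - b - k) h hh (by omega)

/-- In a sparse numerical semigroup of genus at least `2`, no two consecutive integers below the
Frobenius number both belong to the semigroup. -/
theorem IsSparse.succ_notMem {H : Set ℕ} {g : ℕ} (hg : 1 < g)
    (hH : IsNumericalSemigroupOfGenus H g) (hs : IsSparse H g) {u : ℕ} (hu : u ∈ H)
    (huF : u < gap H g) : u + 1 ∉ H := by
  classical
  obtain ⟨h0, hadd, hfin, hcard⟩ := hH
  intro hu1
  have hfin' : (Set.ofPred fun n => n ∉ H).Finite := hfin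
  have hc : hfin'.toFinset.card = g := by
    rw [← Set.ncard_eq_toFinset_card _ hfin']; exact hcard
  have h1 : 1 ∉ H := by
    intro h1
    have hall : ∀ n, n ∈ H := fun n => by
      induction n with
      | zero => exact h0
      | succ n ih => exact hadd _ ih _ h1
    have : Hᶜ = ∅ := by ext n; simp [hall n]
    rw [this, Set.ncard_empty] at hcard
    omega
  have hu0 : u ≠ 0 := by rintro rfl; exact h1 hu1
  have hu1' : u ≠ 1 := by rintro rfl; exact h1 hu
  set p : ℕ → Prop := fun n => n ∉ H
  set j := Nat.count p u with hj
  have hjpos : 0 < j := by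
    have h := Nat.count_strict_mono (p := p) (m := 1) (n := u) h1 (by omega)
    omega
  have hjg : j ≤ g - 1 := by
    have hcn : Nat.count p (Nat.nth p (g - 1)) = g - 1 :=
      Nat.count_nth (fun hf => by
        have : hf.toFinset.card = g := hc
        omega)
    rw [← hcn]
    exact Nat.count_monotone p huF.le
  have hlt : ∀ hf : (Set.ofPred p).Finite, j < hf.toFinset.card := fun hf => by
    have : hf.toFinset.card = g := hc
    omega
  have hlow : Nat.nth p (j - 1) < u := Nat.nth_lt_of_lt_count (by omega)
  have hhigh : u ≤ Nat.nth p j := by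
    by_contra hcon
    have h := Nat.count_strict_mono (p := p) (Nat.nth_mem j hlt) (not_le.1 hcon)
    rw [Nat.count_nth hlt] at h
    omega
  have hmem : Nat.nth p j ∉ H := Nat.nth_mem j hlt
  have hne : Nat.nth p j ≠ u := fun h => hmem (h ▸ hu)
  have hne1 : Nat.nth p j ≠ u + 1 := fun h => hmem (h ▸ hu1)
  have hspj := hs j hjpos hjg
  simp only [gap, Nat.add_sub_cancel] at hspj
  change Nat.nth p j - Nat.nth p (j - 1) ≤ 2 at hspj
  omega

open Classical in
/-- The elements of a numerical semigroup of positive genus `g` below its Frobenius number `F`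
number `F + 1 - g`, and `F` is a gap. -/
theorem IsNumericalSemigroupOfGenus.card_filter_add {H : Set ℕ} {g : ℕ} (hg : 0 < g)
    (hH : IsNumericalSemigroupOfGenus H g) :
    gap H g ∉ H ∧ ((Finset.range (gap H g)).filter (· ∈ H)).card + g = gap H g + 1 := by
  obtain ⟨-, -, hfin, hcard⟩ := hH
  have hfin' : (Set.ofPred fun n => n ∉ H).Finite := hfin
  have hc : hfin'.toFinset.card = g := by
    rw [← Set.ncard_eq_toFinset_card _ hfin']; exact hcard
  have hlt : ∀ hf : (Set.ofPred fun n => n ∉ H).Finite, g - 1 < hf.toFinset.card := fun hf => by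
    have : hf.toFinset.card = g := hc
    omega
  refine ⟨Nat.nth_mem (g - 1) hlt, ?_⟩
  have h := Nat.count_nth hlt
  rw [Nat.count_eq_card_filter_range] at h
  have h2 := Finset.card_filter_add_card_filter_not (s := Finset.range (gap H g)) (· ∈ H)
  rw [Finset.card_range] at h2
  change ((Finset.range (gap H g)).filter (fun n => n ∉ H)).card = g - 1 at h
  omega

/-- **Corollary.** Let `H` be a sparse numerical semigroup of genus `g > 1` with odd
Frobenius number `ℓ_g = 2g - (2r+1)`. Then either `g ≤ 4r + 1`, or every element of
`H` smaller than `ℓ_g` is even. -/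
theorem genus_bound_odd_frobenius (H : Set ℕ) (g r : ℕ) (hg : 1 < g)
    (hH : IsNumericalSemigroupOfGenus H g) (hs : IsSparse H g)
    (hF : gap H g = 2 * g - (2 * r + 1)) :
    g ≤ 4 * r + 1 ∨ ∀ n ∈ H, n < gap H g → Even n := by
  classical
  by_contra! hcon
  obtain ⟨hgr, h, hh, hhF, hodd⟩ := hcon
  obtain ⟨hFmem, hcard⟩ := hH.card_filter_add (by omega)
  have hle := three_mul_card_le_of_odd_mem hH.2.1 hFmem ⟨g - r - 1, by omega⟩
    (fun u hu huF => hs.succ_notMem hg hH hu huF) hh (Nat.not_even_iff_odd.1 hodd) hhF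
  omega
end

section
/- Let H' be any numerical semigroup of genus r ≥ 1 and set H := 2H' ∪ H_{6r+1} = {2n : n ∈ H'} ∪ {m ∈ ℕ : m ≥ 6r + 2}. Then H is a limit sparse numerical semigroup of genus 4r + 1 with odd Frobenius number 6r + 1 and even multiplicity. Conversely, every limit sparse numerical semigroup with odd Frobenius number ℓ_g = 2g - (2r + 1) = 6r + 1 and even multiplicity arises in this way from a numerical semigroup H' of genus r. Moreover, H is Arf if and only if H' is Arf. -/
/-- `H` is an Arf semigroup: `a + b - c ∈ H` for all `a ≥ b ≥ c` in `H`. -/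
def IsArf (H : Set ℕ) : Prop :=
  ∀ a ∈ H, ∀ b ∈ H, ∀ c ∈ H, c ≤ b → b ≤ a → a + b - c ∈ H

section NumericalSemigroup

variable {H : Set ℕ} {g : ℕ}

theorem gap_notMem (h : IsNumericalSemigroupOfGenus H g) {i : ℕ} (hi : 1 ≤ i) (hig : i ≤ g) :
    gap H i ∉ H := by
  obtain ⟨-, -, hf, hc⟩ := h
  have hcard : hf.toFinset.card = g := by rw [← hc, Set.ncard_eq_toFinset_card _ hf]
  exact Nat.nth_mem_of_lt_card (p := fun n => n ∉ H) hf
    (show i - 1 < hf.toFinset.card by omega)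

theorem gap_lt_gap (h : IsNumericalSemigroupOfGenus H g) {i j : ℕ} (hi : 1 ≤ i) (hij : i < j)
    (hj : j ≤ g) : gap H i < gap H j := by
  obtain ⟨-, -, hf, hc⟩ := h
  have hcard : hf.toFinset.card = g := by rw [← hc, Set.ncard_eq_toFinset_card _ hf]
  exact Nat.nth_lt_nth_of_lt_card (p := fun n => n ∉ H) hf (show i - 1 < j - 1 by omega)
    (show j - 1 < hf.toFinset.card by omega)

theorem exists_gap_eq (h : IsNumericalSemigroupOfGenus H g) {x : ℕ} (hx : x ∉ H) :
    ∃ i, 1 ≤ i ∧ i ≤ g ∧ gap H i = x := by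
  obtain ⟨-, -, hf, hc⟩ := h
  have hcard : hf.toFinset.card = g := by rw [← hc, Set.ncard_eq_toFinset_card _ hf]
  obtain ⟨n, hn, hnx⟩ := Nat.exists_lt_card_finite_nth_eq (p := fun n => n ∉ H) hf hx
  have hn' : n < hf.toFinset.card := hn
  exact ⟨n + 1, by omega, by omega, hnx⟩

theorem le_gap_of_notMem (h : IsNumericalSemigroupOfGenus H g) {x : ℕ} (hx : x ∉ H) :
    x ≤ gap H g := by
  obtain ⟨i, hi, hig, rfl⟩ := exists_gap_eq h hx
  rcases hig.eq_or_lt with rfl | hlt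
  · exact le_rfl
  · exact (gap_lt_gap h hi hlt le_rfl).le

theorem mem_of_gap_lt_of_lt_gap (h : IsNumericalSemigroupOfGenus H g) {i x : ℕ} (hi : 1 ≤ i)
    (hig : i < g) (h₁ : gap H i < x) (h₂ : x < gap H (i + 1)) : x ∈ H := by
  by_contra hx
  obtain ⟨k, hk, hkg, rfl⟩ := exists_gap_eq h hx
  rcases lt_trichotomy k i with hki | rfl | hki
  · exact (gap_lt_gap h hk hki hig.le).not_gt h₁
  · exact h₁.false
  · rcases (Nat.succ_le_of_lt hki).eq_or_lt with rfl | hlt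
    · exact h₂.false
    · exact (gap_lt_gap h (by omega) hlt hkg).not_gt h₂

theorem one_notMem (h : IsNumericalSemigroupOfGenus H g) (hg : 1 ≤ g) : 1 ∉ H := by
  intro h1
  have hall : ∀ n, n ∈ H := fun n => by
    induction n with
    | zero => exact h.1
    | succ n ih => exact h.2.1 n ih 1 h1
  exact gap_notMem h hg le_rfl (hall _)

theorem gap_one (h : IsNumericalSemigroupOfGenus H g) (hg : 1 ≤ g) : gap H 1 = 1 := by
  obtain ⟨i, hi, hig, hi1⟩ := exists_gap_eq h (one_notMem h hg)
  rcases hi.eq_or_lt with rfl | hlt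
  · exact hi1
  · have h0 : gap H 1 = 0 := by have := gap_lt_gap h le_rfl hlt hig; omega
    exact absurd (h0 ▸ h.1) (gap_notMem h le_rfl hg)

/-- A sparse semigroup has no two consecutive elements below its Frobenius number. -/
theorem IsSparse.gap_lt_succ (hs : IsSparse H g) (h : IsNumericalSemigroupOfGenus H g)
    (hg : 1 ≤ g) {x : ℕ} (hx : x ∈ H) (hx' : x + 1 ∈ H) : gap H g < x + 1 := by
  have h1 := one_notMem h hg
  have hx0 : x ≠ 0 := by rintro rfl; exact h1 hx'
  have hx1 : x ≠ 1 := by rintro rfl; exact h1 hx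
  have key : ∀ i, 1 ≤ i → i ≤ g → gap H i < x := by
    intro i hi
    induction i, hi using Nat.le_induction with
    | base => intro _; rw [gap_one h hg]; omega
    | succ i hi ih =>
      intro hig
      have := ih (by omega)
      have hd := hs i hi (by omega)
      have hne : gap H (i + 1) ≠ x := fun he => gap_notMem h (by omega) hig (he ▸ hx)
      have hne' : gap H (i + 1) ≠ x + 1 := fun he => gap_notMem h (by omega) hig (he ▸ hx')
      omega
  have := key g hg le_rfl
  omega

theorem isSparse_of_gap_le_succ (h : IsNumericalSemigroupOfGenus H g)
    (hs : ∀ x ∈ H, x + 1 ∈ H → gap H g ≤ x + 1) : IsSparse H g := by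
  intro i hi hig
  by_contra hlt
  have h₁ := mem_of_gap_lt_of_lt_gap (x := gap H i + 1) h hi (by omega) (by omega) (by omega)
  have h₂ := mem_of_gap_lt_of_lt_gap (x := gap H i + 1 + 1) h hi (by omega) (by omega) (by omega)
  have := hs _ h₁ h₂
  have := le_gap_of_notMem h (gap_notMem h (i := i + 1) (by omega) (by omega))
  omega

theorem IsSparse.leaps (hs : IsSparse H g) (h : IsNumericalSemigroupOfGenus H g) (hg : 1 ≤ g) :
    numSingle H g + numDouble H g + 1 = g ∧
      numSingle H g + 2 * numDouble H g + 1 = gap H g := by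
  have hset : ∀ k, {i : ℕ | 1 ≤ i ∧ i ≤ g - 1 ∧ gap H (i + 1) - gap H i = k}.ncard =
      ∑ i ∈ Finset.Ico 1 g, if gap H (i + 1) - gap H i = k then 1 else 0 := by
    intro k
    rw [← Finset.card_filter, ← Set.ncard_coe_finset]
    congr 1
    ext i
    simp only [Set.mem_ofPred_eq, Finset.coe_filter, Finset.mem_Ico]
    omega
  have key : ∀ n, 1 ≤ n → n ≤ g →
      (∑ i ∈ Finset.Ico 1 n, if gap H (i + 1) - gap H i = 1 then 1 else 0) +
        (∑ i ∈ Finset.Ico 1 n, if gap H (i + 1) - gap H i = 2 then 1 else 0) + 1 = n ∧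
      (∑ i ∈ Finset.Ico 1 n, if gap H (i + 1) - gap H i = 1 then 1 else 0) +
        2 * (∑ i ∈ Finset.Ico 1 n, if gap H (i + 1) - gap H i = 2 then 1 else 0) + 1 =
          gap H n := by
    intro n hn
    induction n, hn using Nat.le_induction with
    | base => intro _; simp [gap_one h hg]
    | succ n hn ih =>
      intro hng
      obtain ⟨ih₁, ih₂⟩ := ih (by omega)
      have hd := hs n hn (by omega)
      have hlt := gap_lt_gap h hn n.lt_add_one hng
      rw [Finset.sum_Ico_succ_top hn, Finset.sum_Ico_succ_top hn]
      split_ifs <;> omega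
  unfold numSingle numDouble
  rw [hset, hset]
  exact key g hg le_rfl

/-- Every gap of a numerical semigroup of genus `g` is at most `2 * g - 1`. -/
theorem lt_two_mul_of_notMem (h : IsNumericalSemigroupOfGenus H g) {x : ℕ} (hx : x ∉ H) :
    x < 2 * g := by
  classical
  obtain ⟨-, hadd, hf, hc⟩ := h
  have hG : ((Finset.range (x + 1)).filter (· ∉ H)).card ≤ g := by
    rw [← hc, ← Set.ncard_coe_finset]
    refine Set.ncard_le_ncard (fun a ha => ?_) hf
    simpa using (Finset.mem_filter.1 ha).2
  have hA : ((Finset.range (x + 1)).filter (· ∈ H)).card ≤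
      ((Finset.range (x + 1)).filter (· ∉ H)).card := by
    refine Finset.card_le_card_of_injOn (fun a => x - a) ?_ ?_
    · intro a ha
      simp only [Finset.coe_filter, Finset.mem_range, Set.mem_ofPred_eq] at ha ⊢
      refine ⟨by omega, fun hxa => hx ?_⟩
      have := hadd a ha.2 _ hxa
      rwa [show a + (x - a) = x by omega] at this
    · intro a ha b hb hab
      simp only [Finset.coe_filter, Finset.mem_range, Set.mem_ofPred_eq] at ha hb hab
      omega
  have := Finset.card_filter_add_card_filter_not (s := Finset.range (x + 1)) (· ∈ H)
  rw [Finset.card_range] at this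
  omega

theorem card_filter_mem_add_genus (h : IsNumericalSemigroupOfGenus H g) [DecidablePred (· ∈ H)]
    {F : ℕ} (hF : ∀ x, x ∉ H → x ≤ F) :
    ((Finset.range (F + 1)).filter (· ∈ H)).card + g = F + 1 := by
  have hG : ((Finset.range (F + 1)).filter (· ∉ H)).card = g := by
    rw [← h.2.2.2, ← Set.ncard_coe_finset]
    congr 1
    ext a
    simp only [Finset.coe_filter, Finset.mem_range, Set.mem_ofPred_eq, Set.mem_compl_iff]
    exact ⟨fun ha => ha.2, fun ha => ⟨Nat.lt_succ_of_le (hF a ha), ha⟩⟩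
  have := Finset.card_filter_add_card_filter_not (s := Finset.range (F + 1)) (· ∈ H)
  rw [Finset.card_range] at this
  omega

end NumericalSemigroup

/-- The elements `a`, the reflections `F - a` and the numbers `z` such that neither `z` nor
`F - z` is an element partition `{0, …, F}`. -/
theorem two_mul_card_filter_mem_add {H : Set ℕ} [DecidablePred (· ∈ H)] {F : ℕ}
    (hadd : ∀ a ∈ H, ∀ b ∈ H, a + b ∈ H) (hF : F ∉ H) :
    2 * ((Finset.range (F + 1)).filter (· ∈ H)).card +
      ((Finset.range (F + 1)).filter fun z => z ∉ H ∧ F - z ∉ H).card = F + 1 := by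
  have hrefl : ((Finset.range (F + 1)).filter (F - · ∈ H)).card =
      ((Finset.range (F + 1)).filter (· ∈ H)).card := by
    refine Finset.card_nbij' (F - ·) (F - ·) ?_ ?_ ?_ ?_ <;> intro a ha <;>
      simp only [Finset.coe_filter, Finset.mem_range, Set.mem_ofPred_eq] at ha ⊢
    · exact ⟨by omega, ha.2⟩
    · exact ⟨by omega, by rw [show F - (F - a) = a by omega]; exact ha.2⟩
    · omega
    · omega
  have hsplit : ((Finset.range (F + 1)).filter (· ∉ H)).card =
      ((Finset.range (F + 1)).filter (F - · ∈ H)).card +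
      ((Finset.range (F + 1)).filter fun z => z ∉ H ∧ F - z ∉ H).card := by
    rw [← Finset.card_filter_add_card_filter_not (s := (Finset.range (F + 1)).filter (· ∉ H))
      (F - · ∈ H), Finset.filter_filter, Finset.filter_filter]
    congr 2
    refine Finset.filter_congr fun a ha => ⟨fun h => h.2, fun h => ⟨fun haH => hF ?_, h⟩⟩
    have := hadd a haH _ h
    rwa [show a + (F - a) = F by have := Finset.mem_range.1 ha; omega] at this
  have := Finset.card_filter_add_card_filter_not (s := Finset.range (F + 1)) (· ∈ H)
  rw [Finset.card_range] at this
  omega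

/-- Let `F` be an odd gap of `H` below which `H` has no two consecutive elements, and suppose
that every odd element of `H` exceeds some positive even one. If more than a third of
`{0, …, F}` lies in `H`, then all elements of `H` below `F` are even. -/
theorem even_of_mem_of_lt {H : Set ℕ} [DecidablePred (· ∈ H)] {F : ℕ}
    (hadd : ∀ a ∈ H, ∀ b ∈ H, a + b ∈ H) (hF : F ∉ H) (hFodd : Odd F)
    (hsp : ∀ x ∈ H, x + 1 ∈ H → F < x + 1)
    (heven : ∀ x ∈ H, Odd x → ∃ y ∈ H, Even y ∧ 0 < y ∧ y < x)
    (hcard : F + 1 < 3 * ((Finset.range (F + 1)).filter (· ∈ H)).card) :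
    ∀ x ∈ H, x < F → Even x := by
  by_contra! hex
  obtain ⟨q, hq, hqF, hqodd⟩ := hex
  rw [Nat.not_even_iff_odd] at hqodd
  -- the largest odd element below `F`
  obtain ⟨x, ⟨hx, hxF, hxodd⟩, hxmax⟩ : ∃ x, (x ∈ H ∧ x < F ∧ Odd x) ∧
      ∀ y, y ∈ H → y < F → Odd y → y ≤ x := by
    have hfin : {x | x ∈ H ∧ x < F ∧ Odd x}.Finite :=
      (Set.finite_Iio F).subset fun y hy => hy.2.1
    obtain ⟨x, hx, hmax⟩ := Set.exists_max_image _ id hfin ⟨q, hq, hqF, hqodd⟩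
    exact ⟨x, hx, fun y h₁ h₂ h₃ => hmax y ⟨h₁, h₂, h₃⟩⟩
  have hexists : ∃ t, 2 * t + 1 ≤ F ∧ F - (2 * t + 1) ∉ H := by
    obtain ⟨k, hk⟩ := hFodd
    obtain ⟨l, hl⟩ := hxodd
    refine ⟨k - l - 1, by omega, fun hmem => ?_⟩
    rw [show F - (2 * (k - l - 1) + 1) = x + 1 by omega] at hmem
    have := hsp x hx hmem
    omega
  obtain ⟨t, ⟨htF, ht⟩, htmin⟩ : ∃ t, (2 * t + 1 ≤ F ∧ F - (2 * t + 1) ∉ H) ∧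
      ∀ j < t, F - (2 * j + 1) ∈ H := by
    refine ⟨Nat.find hexists, Nat.find_spec hexists, fun j hj => ?_⟩
    have h₁ := Nat.find_min hexists hj
    have h₂ := (Nat.find_spec hexists).1
    by_contra h₃
    exact h₁ ⟨by omega, h₃⟩
  have hodd : ∀ j, j ≤ t → F - 2 * j ∉ H := by
    intro j hj hmem
    rcases Nat.eq_zero_or_pos j with rfl | hj0
    · exact hF hmem
    · have h₁ := htmin (j - 1) (by omega)
      rw [show F - (2 * (j - 1) + 1) = F - 2 * j + 1 by omega] at h₁
      have := hsp _ hmem h₁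
      omega
  have hxt : x + 2 * t < F := by
    by_contra hle
    obtain ⟨k, hk⟩ := hFodd
    obtain ⟨l, hl⟩ := hxodd
    exact hodd (k - l) (by omega) (by rwa [show F - 2 * (k - l) = x by omega])
  have hsmall : ∀ j, 1 ≤ j → j ≤ t → 2 * j ∉ H := by
    intro j hj hjt hmem
    have := hxmax _ (hadd x hx _ hmem) (by omega) (hxodd.add_even (even_two_mul j))
    omega
  have htodd : 2 * t + 1 ∉ H := by
    intro hmem
    obtain ⟨y, hy, ⟨j, hj⟩, hy0, hyt⟩ := heven _ hmem ⟨t, rfl⟩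
    exact hsmall j (by omega) (by omega) (by rwa [two_mul, ← hj])
  have hle : ((Finset.range (F + 1)).filter (· ∈ H)).card ≤
      ((Finset.range (F + 1)).filter fun z => z ∉ H ∧ F - z ∉ H).card := by
    have hlast : ∀ a ∈ H, a ≤ F → F < a + 2 * t + 1 →
        ∃ j, 1 ≤ j ∧ j ≤ t ∧ F + 1 - a = 2 * j := by
      intro a ha haF hlt
      rcases Nat.even_or_odd' (F - a) with ⟨j, hj | hj⟩
      · exact absurd (by rwa [show F - 2 * j = a by omega]) (hodd j (by omega))
      · exact ⟨j + 1, by omega, by omega, by omega⟩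
    refine Finset.card_le_card_of_injOn (fun a => if F < a + 2 * t + 1 then F + 1 - a else
      if a + 2 * t + 1 ∈ H then a + 2 * t else a + 2 * t + 1) ?_ ?_
    · intro a ha
      simp only [Finset.coe_filter, Finset.mem_range, Set.mem_ofPred_eq] at ha ⊢
      obtain ⟨haF, ha⟩ := ha
      split_ifs with h₁ h₂
      · obtain ⟨j, hj, hjt, hja⟩ := hlast a ha (by omega) h₁
        rw [hja]
        exact ⟨by omega, hsmall j hj hjt, hodd j hjt⟩
      · refine ⟨by omega, fun hmem => ?_, fun hmem => hodd t le_rfl ?_⟩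
        · have h₃ := hsp _ hmem h₂
          exact hF (by rwa [show F = a + 2 * t + 1 by omega])
        · have := hadd a ha _ hmem
          rwa [show a + (F - (a + 2 * t)) = F - 2 * t by omega] at this
      · refine ⟨by omega, h₂, fun hmem => ht ?_⟩
        have := hadd a ha _ hmem
        rwa [show a + (F - (a + 2 * t + 1)) = F - (2 * t + 1) by omega] at this
    · have hzero : ∀ a, a + 2 * t + 1 ∈ H → a ≠ 0 := by
        rintro _ hmem rfl
        exact htodd (by rwa [Nat.zero_add] at hmem)
      intro a ha b hb hab
      simp only [Finset.coe_filter, Finset.mem_range, Set.mem_ofPred_eq] at ha hb hab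
      obtain ⟨haF, ha⟩ := ha
      obtain ⟨hbF, hb⟩ := hb
      have hab' : a + 1 = b → F < a + 1 := fun h => hsp a ha (h ▸ hb)
      have hba' : b + 1 = a → F < b + 1 := fun h => hsp b hb (h ▸ ha)
      have hza := hzero a
      have hzb := hzero b
      split_ifs at hab <;> grind
  have := two_mul_card_filter_mem_add hadd hF
  omega

section Doubling

variable {H' : Set ℕ} {r : ℕ}

theorem compl_doubling (hH' : ∀ n, n ∉ H' → n ≤ 3 * r) :
    ({n : ℕ | ∃ m ∈ H', n = 2 * m} ∪ {m : ℕ | 6 * r + 2 ≤ m})ᶜ =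
      (2 * ·) '' H'ᶜ ∪ ↑((Finset.range (3 * r + 1)).image (2 * · + 1)) := by
  ext x
  simp only [Set.mem_compl_iff, Set.mem_union, Set.mem_ofPred_eq, not_or, not_exists, not_and,
    not_le, Set.mem_image, Finset.coe_image, Finset.coe_range, Set.mem_Iio]
  rcases Nat.even_or_odd' x with ⟨k, rfl | rfl⟩
  · refine ⟨fun h => Or.inl ⟨k, fun hk => h.1 k hk rfl, rfl⟩, ?_⟩
    rintro (⟨y, hy, hyk⟩ | ⟨y, -, hyk⟩)
    · obtain rfl : y = k := by omega
      have := hH' y hy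
      refine ⟨fun m hm hmy => hy ?_, by omega⟩
      rwa [show y = m by omega]
    · omega
  · refine ⟨fun h => Or.inr ⟨k, by omega, rfl⟩, ?_⟩
    rintro (⟨y, -, hyk⟩ | ⟨y, hy, hyk⟩)
    · omega
    · exact ⟨fun m _ hm => by omega, by omega⟩

theorem finite_compl_doubling (hH' : ∀ n, n ∉ H' → n ≤ 3 * r) :
    ({n : ℕ | ∃ m ∈ H', n = 2 * m} ∪ {m : ℕ | 6 * r + 2 ≤ m})ᶜ.Finite := by
  rw [compl_doubling hH']
  exact (((Set.finite_Iic (3 * r)).subset hH').image _).union (Finset.finite_toSet _)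

theorem ncard_compl_doubling (hH' : ∀ n, n ∉ H' → n ≤ 3 * r) :
    ({n : ℕ | ∃ m ∈ H', n = 2 * m} ∪ {m : ℕ | 6 * r + 2 ≤ m})ᶜ.ncard =
      H'ᶜ.ncard + (3 * r + 1) := by
  have hfin : H'ᶜ.Finite := (Set.finite_Iic (3 * r)).subset hH'
  rw [compl_doubling hH', Set.ncard_union_eq _ (hfin.image _) (Finset.finite_toSet _),
    Set.ncard_image_of_injective _ fun a b hab => by simpa using hab, Set.ncard_coe_finset,
    Finset.card_image_of_injective _ fun a b hab => by simpa using hab, Finset.card_range]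
  rw [Set.disjoint_left]
  rintro _ ⟨a, -, rfl⟩ hb
  simp only [Finset.coe_image, Set.mem_image] at hb
  obtain ⟨b, -, hb⟩ := hb
  omega

theorem isNumericalSemigroupOfGenus_doubling (h : IsNumericalSemigroupOfGenus H' r) :
    IsNumericalSemigroupOfGenus ({n : ℕ | ∃ m ∈ H', n = 2 * m} ∪ {m : ℕ | 6 * r + 2 ≤ m})
      (4 * r + 1) := by
  have hH' : ∀ n, n ∉ H' → n ≤ 3 * r := fun n hn => by
    have := lt_two_mul_of_notMem h hn
    omega
  refine ⟨Or.inl ⟨0, h.1, rfl⟩, ?_, finite_compl_doubling hH', ?_⟩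
  · rintro a (⟨m, hm, rfl⟩ | ha) b (⟨n, hn, rfl⟩ | hb)
    · exact Or.inl ⟨m + n, h.2.1 m hm n hn, by ring⟩
    all_goals
      right
      simp only [Set.mem_ofPred_eq] at *
      omega
  · rw [ncard_compl_doubling hH', h.2.2.2]
    ring

theorem isArf_doubling_iff (hr : 1 ≤ r) (h : IsNumericalSemigroupOfGenus H' r) :
    IsArf ({n : ℕ | ∃ m ∈ H', n = 2 * m} ∪ {m : ℕ | 6 * r + 2 ≤ m}) ↔ IsArf H' := by
  constructor
  · intro hA a ha b hb c hc hcb hba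
    rcases hA (2 * a) (Or.inl ⟨a, ha, rfl⟩) (2 * b) (Or.inl ⟨b, hb, rfl⟩) (2 * c)
      (Or.inl ⟨c, hc, rfl⟩) (by omega) (by omega) with ⟨m, hm, he⟩ | hle
    · rwa [show a + b - c = m by omega]
    · simp only [Set.mem_ofPred_eq] at hle
      by_contra hn
      have := lt_two_mul_of_notMem h hn
      omega
  · rintro hA a ha b hb c hc hcb hba
    by_cases hle : 6 * r + 2 ≤ a
    · right
      simp only [Set.mem_ofPred_eq]
      omega
    · rcases ha with ⟨m, hm, rfl⟩ | ha
      · rcases hb with ⟨n, hn, rfl⟩ | hb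
        · rcases hc with ⟨k, hk, rfl⟩ | hc
          · exact Or.inl ⟨m + n - k, hA m hm n hn k hk (by omega) (by omega), by omega⟩
          · exact absurd (hc.trans (hcb.trans hba)) hle
        · exact absurd (hb.trans hba) hle
      · exact absurd ha hle

theorem even_multOf_doubling (hr : 1 ≤ r) (h : IsNumericalSemigroupOfGenus H' r) :
    Even (multOf ({n : ℕ | ∃ m ∈ H', n = 2 * m} ∪ {m : ℕ | 6 * r + 2 ≤ m})) := by
  have h2r : 2 * r ∈ H' := by
    by_contra hn
    exact (lt_two_mul_of_notMem h hn).false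
  have hmem : 4 * r ∈ {n : ℕ | n ∈ ({n : ℕ | ∃ m ∈ H', n = 2 * m} ∪ {m : ℕ | 6 * r + 2 ≤ m}) ∧
      0 < n} := ⟨Or.inl ⟨2 * r, h2r, by ring⟩, by omega⟩
  have hle : multOf _ ≤ 4 * r := Nat.sInf_le hmem
  rcases (Nat.sInf_mem ⟨_, hmem⟩).1 with ⟨m, -, hm⟩ | hlt
  · exact ⟨m, by rw [← two_mul]; exact hm⟩
  · exact absurd (le_trans hlt hle) (by omega)

theorem odd_notMem_doubling {k : ℕ} (hk : k ≤ 3 * r) :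
    2 * k + 1 ∉ ({n : ℕ | ∃ m ∈ H', n = 2 * m} ∪ {m : ℕ | 6 * r + 2 ≤ m}) := by
  rintro (⟨m, -, hm⟩ | hm)
  · omega
  · simp only [Set.mem_ofPred_eq] at hm
    omega

theorem gap_doubling (h : IsNumericalSemigroupOfGenus H' r) :
    gap ({n : ℕ | ∃ m ∈ H', n = 2 * m} ∪ {m : ℕ | 6 * r + 2 ≤ m}) (4 * r + 1) = 6 * r + 1 := by
  have hH := isNumericalSemigroupOfGenus_doubling h
  have h₁ := le_gap_of_notMem hH (odd_notMem_doubling (H' := H') (le_refl (3 * r)))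
  have h₂ := gap_notMem hH (by omega) le_rfl
  have h₃ : ¬ 6 * r + 2 ≤
      gap ({n : ℕ | ∃ m ∈ H', n = 2 * m} ∪ {m : ℕ | 6 * r + 2 ≤ m}) (4 * r + 1) :=
    fun hle => h₂ (Or.inr hle)
  omega

theorem isSparse_doubling (h : IsNumericalSemigroupOfGenus H' r) :
    IsSparse ({n : ℕ | ∃ m ∈ H', n = 2 * m} ∪ {m : ℕ | 6 * r + 2 ≤ m}) (4 * r + 1) := by
  refine isSparse_of_gap_le_succ (isNumericalSemigroupOfGenus_doubling h) fun x hx hx' => ?_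
  rw [gap_doubling h]
  by_contra hlt
  rcases Nat.even_or_odd' x with ⟨k, rfl | rfl⟩
  · exact odd_notMem_doubling (by omega) hx'
  · exact odd_notMem_doubling (by omega) hx

end Doubling

theorem exists_even_mem_lt {H : Set ℕ} (hm : Even (multOf H)) {x : ℕ} (hx : x ∈ H)
    (hxodd : Odd x) : ∃ y ∈ H, Even y ∧ 0 < y ∧ y < x := by
  have hmem : x ∈ {n : ℕ | n ∈ H ∧ 0 < n} := ⟨hx, hxodd.pos⟩
  obtain ⟨h₁, h₂⟩ := Nat.sInf_mem ⟨_, hmem⟩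
  have hle : multOf H ≤ x := Nat.sInf_le hmem
  refine ⟨multOf H, h₁, hm, h₂, hle.lt_of_ne fun he => ?_⟩
  rw [he] at hm
  exact (Nat.not_even_iff_odd.2 hxodd) hm

/-- A numerical semigroup with Frobenius number `6 * r + 1` and genus `4 * r + 1`, all of whose
elements below the Frobenius number are even, comes from a semigroup of genus `r` by doubling. -/
theorem exists_eq_doubling {H : Set ℕ} {r : ℕ} (h : IsNumericalSemigroupOfGenus H (4 * r + 1))
    (hgap : gap H (4 * r + 1) = 6 * r + 1) (heven : ∀ x ∈ H, x < 6 * r + 1 → Even x) :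
    ∃ H' : Set ℕ, IsNumericalSemigroupOfGenus H' r ∧
      H = {n : ℕ | ∃ m ∈ H', n = 2 * m} ∪ {m : ℕ | 6 * r + 2 ≤ m} := by
  have hle : ∀ x, x ∉ H → x ≤ 6 * r + 1 := fun x hx => hgap ▸ le_gap_of_notMem h hx
  have hF : 6 * r + 1 ∉ H := hgap ▸ gap_notMem h (by omega) le_rfl
  have hH' : ∀ n, n ∉ {n | 2 * n ∈ H} → n ≤ 3 * r := fun n hn => by
    have := hle _ hn
    omega
  have heq : H = {n : ℕ | ∃ m ∈ {n | 2 * n ∈ H}, n = 2 * m} ∪ {m : ℕ | 6 * r + 2 ≤ m} := by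
    ext x
    constructor
    · intro hx
      by_cases hxF : 6 * r + 2 ≤ x
      · exact Or.inr hxF
      · have hne : x ≠ 6 * r + 1 := by rintro rfl; exact hF hx
        obtain ⟨m, hm⟩ := heven x hx (by omega)
        rw [← two_mul] at hm
        exact Or.inl ⟨m, by rw [Set.mem_ofPred_eq, ← hm]; exact hx, hm⟩
    · rintro (⟨m, hm, rfl⟩ | hx)
      · exact hm
      · by_contra hn
        have := hle x hn
        simp only [Set.mem_ofPred_eq] at hx
        omega
  refine ⟨{n | 2 * n ∈ H}, ⟨h.1, fun a ha b hb => ?_, (Set.finite_Iic (3 * r)).subset hH', ?_⟩,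
    heq⟩
  · rw [Set.mem_ofPred_eq, mul_add]
    exact h.2.1 _ ha _ hb
  · have h₁ := ncard_compl_doubling hH'
    rw [← heq, h.2.2.2] at h₁
    omega

/-- **Corollary.** Let `H'` be any numerical semigroup of genus `r ≥ 1` and set
`H := 2H' ∪ H_{6r+1} = {2n : n ∈ H'} ∪ {m : m ≥ 6r + 2}`. Then `H` is a limit sparse
numerical semigroup of genus `4r + 1` with odd Frobenius number `6r + 1` and even
multiplicity; moreover `H` is Arf iff `H'` is Arf. Conversely, every limit sparse
numerical semigroup with odd Frobenius number `ℓ_g = 2g - (2r+1) = 6r + 1` and even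
multiplicity arises in this way from a numerical semigroup `H'` of genus `r`. -/
theorem doubling_charact (r : ℕ) (hr : 1 ≤ r) :
    (∀ H' : Set ℕ, IsNumericalSemigroupOfGenus H' r →
      (IsNumericalSemigroupOfGenus
          ({n : ℕ | ∃ m ∈ H', n = 2 * m} ∪ {m : ℕ | 6 * r + 2 ≤ m}) (4 * r + 1) ∧
        IsSparse ({n : ℕ | ∃ m ∈ H', n = 2 * m} ∪ {m : ℕ | 6 * r + 2 ≤ m})
          (4 * r + 1) ∧
        numSingle ({n : ℕ | ∃ m ∈ H', n = 2 * m} ∪ {m : ℕ | 6 * r + 2 ≤ m})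
            (4 * r + 1) =
          numDouble ({n : ℕ | ∃ m ∈ H', n = 2 * m} ∪ {m : ℕ | 6 * r + 2 ≤ m})
            (4 * r + 1) ∧
        gap ({n : ℕ | ∃ m ∈ H', n = 2 * m} ∪ {m : ℕ | 6 * r + 2 ≤ m}) (4 * r + 1) =
          6 * r + 1 ∧
        Even (multOf ({n : ℕ | ∃ m ∈ H', n = 2 * m} ∪ {m : ℕ | 6 * r + 2 ≤ m})) ∧
        (IsArf ({n : ℕ | ∃ m ∈ H', n = 2 * m} ∪ {m : ℕ | 6 * r + 2 ≤ m}) ↔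
          IsArf H'))) ∧
    (∀ H : Set ℕ, ∀ g : ℕ, 1 < g →
      IsNumericalSemigroupOfGenus H g → IsSparse H g →
      numSingle H g = numDouble H g →
      gap H g = 2 * g - (2 * r + 1) → gap H g = 6 * r + 1 →
      Even (multOf H) →
      ∃ H' : Set ℕ, IsNumericalSemigroupOfGenus H' r ∧
        H = {n : ℕ | ∃ m ∈ H', n = 2 * m} ∪ {m : ℕ | 6 * r + 2 ≤ m}) := by
  refine ⟨fun H' h => ?_, fun H g hg h hs _ hgap hgap' hm => ?_⟩
  · have hH := isNumericalSemigroupOfGenus_doubling h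
    have hs := isSparse_doubling h
    have hgap := gap_doubling h
    refine ⟨hH, hs, ?_, hgap, even_multOf_doubling hr h, isArf_doubling_iff hr h⟩
    obtain ⟨h₁, h₂⟩ := hs.leaps hH (by omega)
    omega
  · classical
    obtain rfl : g = 4 * r + 1 := by omega
    refine exists_eq_doubling h hgap' (even_of_mem_of_lt h.2.1
      (hgap' ▸ gap_notMem h (by omega) le_rfl) ⟨3 * r, by ring⟩
      (fun x hx hx' => hgap' ▸ hs.gap_lt_succ h (by omega) hx hx')
      (fun x hx => exists_even_mem_lt hm hx) ?_)
    have := card_filter_mem_add_genus h (F := 6 * r + 1)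
      fun x hx => hgap' ▸ le_gap_of_notMem h hx
    omega
end
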